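/- arXiv:1205.1069 — 3 statements merged into one kernel-verified Lean document; each statement's English description precedes it below -/
import Mathlib

section
/- The function L(σ) = −(2/3)σ + 2·Ω(1/σ, 0), defined for σ > 0, attains a global minimum, and σ is a global minimizer of L if and only if σ is the unique root in the interval (1, 1 + 9/64) of the polynomial x^3 − 12x + 12 (in particular, x^3 − 12x + 12 has exactly one root in that interval). -/
/-- `Omega x y = ∑_{n ∈ ℤ} max(0, 1 - |x n - y|)^2`. -/
noncomputable def Omega (x y : ℝ) : ℝ := ∑' n : ℤ, max 0 (1 - |x * (n : ℝ) - y|) ^ 2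

/-- The limiting value of `(‖f‖₄/‖f‖₂)⁴` for a size-stable family of additive character
polynomials with limiting size `σ`. -/
noncomputable def Lfun (σ : ℝ) : ℝ := -(2 / 3) * σ + 2 * Omega (1 / σ) 0

open Finset in
/-- Explicit value of `Omega (1 / σ) 0` when `N ≤ σ ≤ N + 1`. -/
theorem Omega_one_div_zero {σ : ℝ} (hσ : 0 < σ) (N : ℕ) (h₁ : (N : ℝ) ≤ σ) (h₂ : σ ≤ N + 1) :
    Omega (1 / σ) 0 = 1 + 2 * ∑ i ∈ range N, (1 - ((i : ℝ) + 1) / σ) ^ 2 := by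
  have hin : ∀ i ∈ range N, max 0 (1 - ((i : ℝ) + 1) / σ) ^ 2 = (1 - ((i : ℝ) + 1) / σ) ^ 2 := by
    intro i hi
    have hi' : ((i : ℝ) + 1) ≤ N := by exact_mod_cast mem_range.1 hi
    rw [max_eq_right]
    rw [sub_nonneg, div_le_one hσ]
    linarith
  have hout : ∀ i : ℕ, N ≤ i → max 0 (1 - ((i : ℝ) + 1) / σ) ^ 2 = 0 := by
    intro i hi
    have hi' : (N : ℝ) ≤ i := by exact_mod_cast hi
    rw [max_eq_left, zero_pow two_ne_zero]
    rw [sub_nonpos, one_le_div hσ]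
    linarith
  have hpos : ∀ n : ℕ, |1 / σ * (((n : ℤ)) : ℝ) - 0| = (n : ℝ) / σ := by
    intro n
    rw [sub_zero, Int.cast_natCast, abs_of_nonneg (by positivity)]
    ring
  have hneg : ∀ n : ℕ, |1 / σ * ((-((n : ℤ) + 1) : ℤ) : ℝ) - 0| = ((n : ℝ) + 1) / σ := by
    intro n
    push_cast
    rw [sub_zero, mul_neg, abs_neg, abs_of_nonneg (by positivity)]
    ring
  have hs₁ : HasSum (fun n : ℕ => max 0 (1 - |1 / σ * (((n : ℤ)) : ℝ) - 0|) ^ 2)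
      (∑ n ∈ range (N + 1), max 0 (1 - |1 / σ * (((n : ℤ)) : ℝ) - 0|) ^ 2) := by
    refine hasSum_sum_of_ne_finset_zero fun n hn => ?_
    obtain ⟨m, rfl⟩ : ∃ m, n = m + 1 := ⟨n - 1, by simp at hn; omega⟩
    rw [hpos, Nat.cast_add_one]
    exact hout m (by simp at hn; omega)
  have hs₂ : HasSum (fun n : ℕ => max 0 (1 - |1 / σ * ((-((n : ℤ) + 1) : ℤ) : ℝ) - 0|) ^ 2)
      (∑ n ∈ range N, max 0 (1 - |1 / σ * ((-((n : ℤ) + 1) : ℤ) : ℝ) - 0|) ^ 2) := by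
    refine hasSum_sum_of_ne_finset_zero fun n hn => ?_
    rw [hneg]
    exact hout n (by simpa using hn)
  have hs := HasSum.of_nat_of_neg_add_one
    (f := fun n : ℤ => max 0 (1 - |1 / σ * (n : ℝ) - 0|) ^ 2) hs₁ hs₂
  unfold Omega
  simp only [hpos, hneg] at hs
  rw [hs.tsum_eq, sum_range_succ']
  simp only [Nat.cast_add_one]
  rw [sum_congr rfl hin, Nat.cast_zero, zero_div, sub_zero, max_eq_right zero_le_one]
  ring

theorem Lfun_of_le_one {σ : ℝ} (hσ : 0 < σ) (h : σ ≤ 1) : Lfun σ = -(2 / 3) * σ + 2 := by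
  rw [Lfun, Omega_one_div_zero hσ 0 (by simpa using hσ.le) (by simpa using h)]
  simp

theorem Lfun_of_mem_Icc {σ : ℝ} (h₁ : 1 ≤ σ) (h₂ : σ ≤ 2) :
    Lfun σ = -(2 / 3) * σ + 2 + 4 * (1 - 1 / σ) ^ 2 := by
  rw [Lfun, Omega_one_div_zero (by linarith) 1 (by simpa using h₁) (by norm_num; exact h₂)]
  simp
  ring

open Finset in
theorem sum_sq_sub_eq (s : ℝ) (N : ℕ) :
    ∑ i ∈ range N, (s - ((i : ℝ) + 1)) ^ 2 =
      s ^ 3 / 3 - s ^ 2 / 2 + N / 6 - ((s - N) ^ 3 / 3 - (s - N) ^ 2 / 2) := by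
  induction N with
  | zero => simp
  | succ N ih =>
    rw [sum_range_succ, ih]
    push_cast
    ring

open Finset in
theorem two_thirds_mul_le_Lfun {σ : ℝ} (hσ : 0 < σ) : 2 / 3 * σ ≤ Lfun σ := by
  have h₁ := Nat.floor_le hσ.le
  have h₂ := (Nat.lt_floor_add_one σ).le
  rw [Lfun, Omega_one_div_zero hσ _ h₁ h₂]
  set N := ⌊σ⌋₊
  have hsum : ∑ i ∈ range N, (1 - ((i : ℝ) + 1) / σ) ^ 2 =
      (∑ i ∈ range N, (σ - ((i : ℝ) + 1)) ^ 2) / σ ^ 2 := by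
    rw [sum_div]
    refine sum_congr rfl fun i _ => ?_
    field_simp
  have hlow : σ / 3 - 1 / 2 ≤ ∑ i ∈ range N, (1 - ((i : ℝ) + 1) / σ) ^ 2 := by
    rw [hsum, sum_sq_sub_eq, le_div_iff₀ (by positivity)]
    have hN : (0 : ℝ) ≤ N := N.cast_nonneg
    have ht : 0 ≤ (σ - N) ^ 2 * (1 / 2 - (σ - N) / 3) :=
      mul_nonneg (sq_nonneg _) (by linarith)
    nlinarith
  linarith

/-- At a root `a` of `x³ - 12x + 12`, the difference `Lfun σ - Lfun a` has a double zero. -/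
theorem Lfun_lt_of_mem_Icc {a σ : ℝ} (ha₁ : 1 < a) (ha₂ : a < 1 + 9 / 64)
    (ha : a ^ 3 - 12 * a + 12 = 0) (h₁ : 1 ≤ σ) (h₂ : σ ≤ 2) (hne : σ ≠ a) :
    Lfun a < Lfun σ := by
  rw [Lfun_of_mem_Icc h₁ h₂, Lfun_of_mem_Icc ha₁.le (by linarith), ← sub_pos]
  have ha0 : 0 < a := by linarith
  have hσ0 : 0 < σ := by linarith
  have key : -(2 / 3) * σ + 2 + 4 * (1 - 1 / σ) ^ 2 - (-(2 / 3) * a + 2 + 4 * (1 - 1 / a) ^ 2) =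
      (σ - a) ^ 2 * (4 / a ^ 2 - 2 / 3 * σ) / σ ^ 2 := by
    field_simp
    linear_combination (2 * σ * (a - σ)) * ha
  rw [key]
  have hsq : 0 < (σ - a) ^ 2 := by
    have := sub_ne_zero.2 hne
    positivity
  have hc : 4 / 3 < 4 / a ^ 2 := by
    rw [lt_div_iff₀ (by positivity)]
    nlinarith
  have : 0 < 4 / a ^ 2 - 2 / 3 * σ := by linarith
  positivity

theorem Lfun_lt_of_ne {a σ : ℝ} (ha₁ : 1 < a) (ha₂ : a < 1 + 9 / 64)
    (ha : a ^ 3 - 12 * a + 12 = 0) (hσ : 0 < σ) (hne : σ ≠ a) : Lfun a < Lfun σ := by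
  have hlt : Lfun a < 4 / 3 := by
    have h := Lfun_lt_of_mem_Icc ha₁ ha₂ ha le_rfl one_le_two ha₁.ne
    rw [Lfun_of_le_one one_pos le_rfl] at h
    linarith
  rcases le_total σ 1 with h | h
  · rw [Lfun_of_le_one hσ h]
    linarith
  rcases le_total σ 2 with h' | h'
  · exact Lfun_lt_of_mem_Icc ha₁ ha₂ ha h h' hne
  · linarith [two_thirds_mul_le_Lfun hσ]

/-- `Lfun` attains a global minimum on `(0,∞)`, and `σ` is a global minimizer
iff `σ` is the unique root of `x³ - 12x + 12` in `(1, 1 + 9/64)`. -/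
theorem stmt_2 :
    ∃ a : ℝ, a ∈ Set.Ioo (1 : ℝ) (1 + 9 / 64) ∧ a ^ 3 - 12 * a + 12 = 0 ∧
      (∀ x ∈ Set.Ioo (1 : ℝ) (1 + 9 / 64), x ^ 3 - 12 * x + 12 = 0 → x = a) ∧
      (∀ σ : ℝ, 0 < σ → Lfun a ≤ Lfun σ) ∧
      (∀ σ : ℝ, 0 < σ → ((∀ σ' : ℝ, 0 < σ' → Lfun σ ≤ Lfun σ') ↔ σ = a)) := by
  obtain ⟨a, ⟨ha₁, ha₂⟩, ha⟩ : ∃ a ∈ Set.Ioo (1 : ℝ) (1 + 9 / 64), a ^ 3 - 12 * a + 12 = 0 := by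
    have hcont : ContinuousOn (fun x : ℝ => x ^ 3 - 12 * x + 12) (Set.Icc 1 (1 + 9 / 64)) := by
      fun_prop
    exact intermediate_value_Ioo' (by norm_num) hcont (by constructor <;> norm_num)
  have hmin : ∀ σ : ℝ, 0 < σ → σ ≠ a → Lfun a < Lfun σ := fun σ hσ hne =>
    Lfun_lt_of_ne ha₁ ha₂ ha hσ hne
  have hle : ∀ σ : ℝ, 0 < σ → Lfun a ≤ Lfun σ := fun σ hσ => by
    rcases eq_or_ne σ a with rfl | hne
    · exact le_rfl
    · exact (hmin σ hσ hne).le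
  refine ⟨a, ⟨ha₁, ha₂⟩, ha, ?_, hle, fun σ hσ => ⟨fun h => ?_, fun h => h ▸ hle⟩⟩
  · rintro x ⟨hx₁, hx₂⟩ hx
    have hprod : (x - a) * (x ^ 2 + x * a + a ^ 2 - 12) = 0 := by linear_combination hx - ha
    rcases mul_eq_zero.1 hprod with h | h
    · linarith
    · nlinarith
  · by_contra hne
    exact absurd (h a (by linarith)) (hmin σ hσ hne).not_ge
end

section
/- Fix e ≥ 1. The function K(x_1,…,x_e) = −(2/3)^e ∏_{j=1}^e x_j + 2 ∏_{j=1}^e Ω(1/x_j, 0), defined for x_1,…,x_e > 0, attains a global minimum, and (x_1,…,x_e) is a global minimizer if and only if x_1 = ⋯ = x_e = a_e, where a_e is the unique root in the interval (1, 1 + 3^{e+1}/2^{2e+4}) of the polynomial x^{3e} − (3^e/2^{e−3})(x−1)(3x^2 − 4x + 2)^{e−1} (in particular, this polynomial has exactly one root in that interval). -/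
/-- The limiting value of `(‖f‖₄/‖f‖₂)⁴` for a size-stable family of `e`-variable
non-quadratic multiplicative character polynomials with limiting sizes `x 0, …, x (e-1)`. -/
noncomputable def Kfun (e : ℕ) (x : Fin e → ℝ) : ℝ :=
  -(2 / 3 : ℝ) ^ e * ∏ j, x j + 2 * ∏ j, Omega (1 / x j) 0

/-- Closed form of the symmetric sum `∑_{|n| ≤ N} (1 - |n| / x)^2`. -/
lemma sum_Icc_one_sub_abs_div_sq (x : ℝ) (hx : x ≠ 0) (N : ℕ) :
    ∑ n ∈ Finset.Icc (-(N : ℤ)) N, (1 - |(n : ℝ)| / x) ^ 2 =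
      2 * x / 3 + (N + (x - N) ^ 2 * (3 - 2 * (x - N))) / (3 * x ^ 2) := by
  induction N with
  | zero =>
    simp
    field_simp
    ring
  | succ N ih =>
    have hset : Finset.Icc (-((N + 1 : ℕ) : ℤ)) ((N + 1 : ℕ) : ℤ) =
        insert (-((N : ℤ) + 1)) (insert ((N : ℤ) + 1) (Finset.Icc (-(N : ℤ)) N)) := by
      ext k
      simp only [Finset.mem_Icc, Finset.mem_insert]
      push_cast
      omega
    have habs : |(N : ℝ) + 1| = N + 1 := abs_of_pos (by positivity)
    have habs' : |-1 + -(N : ℝ)| = N + 1 := by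
      rw [← habs, ← abs_neg]
      congr 1
      ring
    rw [hset, Finset.sum_insert, Finset.sum_insert, ih]
    · push_cast
      simp only [neg_add_rev, habs, habs']
      field_simp
      ring
    · simp
    · simp only [Finset.mem_Icc, Finset.mem_insert]
      omega

lemma Omega_one_div_zero_s4 (x : ℝ) (hx : 0 < x) (N : ℕ) (h1 : (N : ℝ) ≤ x) (h2 : x ≤ N + 1) :
    Omega (1 / x) 0 =
      2 * x / 3 + (N + (x - N) ^ 2 * (3 - 2 * (x - N))) / (3 * x ^ 2) := by
  rw [← sum_Icc_one_sub_abs_div_sq x hx.ne' N, Omega]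
  have habs : ∀ n : ℤ, |1 / x * (n : ℝ) - 0| = |(n : ℝ)| / x := by
    intro n
    rw [sub_zero, abs_mul, abs_of_pos (by positivity : 0 < 1 / x)]
    ring
  simp only [habs]
  rw [tsum_eq_sum (s := Finset.Icc (-(N : ℤ)) N)]
  · refine Finset.sum_congr rfl fun n hn => ?_
    rw [Finset.mem_Icc] at hn
    have hn' : |(n : ℝ)| ≤ N := by exact_mod_cast abs_le.mpr hn
    rw [max_eq_right]
    rw [sub_nonneg, div_le_one hx]
    exact hn'.trans h1
  · intro n hn
    rw [Finset.mem_Icc, ← abs_le, not_le] at hn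
    have hn' : (N : ℝ) + 1 ≤ |(n : ℝ)| := by exact_mod_cast hn
    rw [max_eq_left, zero_pow two_ne_zero]
    rw [sub_nonpos, one_le_div hx]
    exact h2.trans hn'

lemma Omega_of_le_one {x : ℝ} (hx : 0 < x) (h : x ≤ 1) : Omega (1 / x) 0 = 1 := by
  rw [Omega_one_div_zero_s4 x hx 0 (by simpa using hx.le) (by simpa using h)]
  simp
  field_simp
  ring

lemma Omega_of_mem_Icc {x : ℝ} (h1 : 1 ≤ x) (h2 : x ≤ 2) :
    Omega (1 / x) 0 = (3 * x ^ 2 - 4 * x + 2) / x ^ 2 := by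
  have hx : 0 < x := by linarith
  rw [Omega_one_div_zero_s4 x hx 1 (by simpa using h1) (by norm_num; linarith)]
  push_cast
  field_simp
  ring

lemma two_thirds_mul_le_Omega {x : ℝ} (hx : 0 < x) : 2 / 3 * x ≤ Omega (1 / x) 0 := by
  have hl := Nat.floor_le hx.le
  have hu := (Nat.lt_floor_add_one x).le
  rw [Omega_one_div_zero_s4 x hx _ hl hu]
  have h3 : 0 ≤ 3 - 2 * (x - (⌊x⌋₊ : ℝ)) := by linarith
  have : 0 ≤ ((⌊x⌋₊ : ℝ) + (x - (⌊x⌋₊ : ℝ)) ^ 2 * (3 - 2 * (x - (⌊x⌋₊ : ℝ)))) / (3 * x ^ 2) := by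
    positivity
  linarith

lemma Omega_gt_line {x : ℝ} (hx : 0 < x) (h : x ∉ Set.Ico (1 : ℝ) (13 / 10)) :
    (x - 1) / 3 < Omega (1 / x) 0 - 1 ∧ 0 ≤ Omega (1 / x) 0 - 1 := by
  rcases lt_or_ge x 1 with h1 | h1
  · rw [Omega_of_le_one hx h1.le]
    constructor <;> linarith
  · have h13 : 13 / 10 ≤ x := by
      by_contra hc
      exact h ⟨h1, not_le.mp hc⟩
    rcases le_or_gt x 2 with h2 | h2
    · rw [Omega_of_mem_Icc h1 h2]
      have key : (x - 1) / 3 < (3 * x ^ 2 - 4 * x + 2) / x ^ 2 - 1 := by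
        rw [lt_sub_iff_add_lt, lt_div_iff₀ (by positivity)]
        nlinarith [mul_pos (by linarith : 0 < x - 1)
          (by nlinarith : 0 < 6 * (x - 1) - x ^ 2)]
      exact ⟨key, by linarith⟩
    · have := two_thirds_mul_le_Omega hx
      constructor <;> linarith

lemma Kfun_eq (e : ℕ) (x : Fin e → ℝ) :
    Kfun e x = 2 * ∏ j, Omega (1 / x j) 0 - ∏ j, (2 / 3 * x j) := by
  rw [Kfun, Finset.prod_mul_distrib, Finset.prod_const, Finset.card_univ, Fintype.card_fin]
  ring

/-- `Kfun` as a function of a single coordinate. -/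
lemma Kfun_update (e : ℕ) (x : Fin e → ℝ) (hx : ∀ j, 0 < x j) (j : Fin e) :
    ∃ G U : ℝ, 0 < U ∧ U ≤ G ∧
      (∀ t, Kfun e (Function.update x j t) = 2 * (Omega (1 / t) 0 * G) - 2 / 3 * t * U) ∧
      ∏ i, Omega (1 / x i) 0 = Omega (1 / x j) 0 * G ∧
      ∏ i, (2 / 3 * x i) = 2 / 3 * x j * U := by
  refine ⟨∏ i ∈ Finset.univ.erase j, Omega (1 / x i) 0,
    ∏ i ∈ Finset.univ.erase j, (2 / 3 * x i), ?_, ?_, ?_, ?_, ?_⟩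
  · exact Finset.prod_pos fun i _ => mul_pos (by norm_num) (hx i)
  · exact Finset.prod_le_prod (fun i _ => (mul_pos (by norm_num) (hx i)).le)
      fun i _ => two_thirds_mul_le_Omega (hx i)
  · intro t
    rw [Kfun_eq, ← Finset.mul_prod_erase _ (fun i => Omega (1 / Function.update x j t i) 0)
        (Finset.mem_univ j),
      ← Finset.mul_prod_erase _ (fun i => 2 / 3 * Function.update x j t i) (Finset.mem_univ j)]
    simp only [Function.update_self]
    have hne : ∀ i ∈ Finset.univ.erase j, Function.update x j t i = x i := fun i hi =>
      Function.update_of_ne (Finset.ne_of_mem_erase hi) _ _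
    rw [Finset.prod_congr rfl fun i hi => by rw [hne i hi],
      Finset.prod_congr rfl fun i hi => congrArg (2 / 3 * ·) (hne i hi)]
  · exact (Finset.mul_prod_erase _ (fun i => Omega (1 / x i) 0) (Finset.mem_univ j)).symm
  · exact (Finset.mul_prod_erase _ (fun i => 2 / 3 * x i) (Finset.mem_univ j)).symm

lemma Kfun_update_one_lt (e : ℕ) (x : Fin e → ℝ) (hx : ∀ j, 0 < x j) (j : Fin e)
    (h : x j ∉ Set.Ico (1 : ℝ) (13 / 10)) : Kfun e (Function.update x j 1) < Kfun e x := by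
  obtain ⟨G, U, hU, hUG, hK, -, -⟩ := Kfun_update e x hx j
  have h1 := hK 1
  have h2 := hK (x j)
  rw [Function.update_eq_self] at h2
  rw [h1, h2, Omega_of_le_one one_pos le_rfl]
  obtain ⟨h3, h4⟩ := Omega_gt_line (hx j) h
  nlinarith [mul_le_mul_of_nonneg_left hUG h4, mul_lt_mul_of_pos_right h3 hU]

/-- Moving all coordinates outside `[1, 13/10)` to `1` does not increase `Kfun`. -/
lemma exists_mem_box_Kfun_le (e : ℕ) (x : Fin e → ℝ) (hx : ∀ j, 0 < x j) :
    ∃ y : Fin e → ℝ, (∀ j, y j ∈ Set.Icc (1 : ℝ) (13 / 10)) ∧ Kfun e y ≤ Kfun e x := by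
  classical
  set c : Fin e → ℝ := fun j => if x j ∈ Set.Ico (1 : ℝ) (13 / 10) then x j else 1 with hc
  have hcmem : ∀ j, c j ∈ Set.Icc (1 : ℝ) (13 / 10) := by
    intro j
    simp only [hc]
    split_ifs with h
    · exact Set.Ico_subset_Icc_self h
    · norm_num
  have key : ∀ s : Finset (Fin e), Kfun e (s.piecewise c x) ≤ Kfun e x := by
    intro s
    induction s using Finset.induction_on with
    | empty => simp
    | insert j s hj ih =>
      rw [Finset.piecewise_insert]
      refine le_trans ?_ ih
      have hval : s.piecewise c x j = x j := Finset.piecewise_eq_of_notMem _ _ _ hj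
      have hpos : ∀ i, 0 < s.piecewise c x i := by
        intro i
        by_cases hi : i ∈ s
        · rw [Finset.piecewise_eq_of_mem _ _ _ hi]
          linarith [(hcmem i).1]
        · rw [Finset.piecewise_eq_of_notMem _ _ _ hi]
          exact hx i
      by_cases h : x j ∈ Set.Ico (1 : ℝ) (13 / 10)
      · have : c j = s.piecewise c x j := by rw [hval]; simp only [hc, if_pos h]
        rw [this, Function.update_eq_self]
      · have : c j = 1 := by simp only [hc, if_neg h]
        rw [this]
        exact (Kfun_update_one_lt e _ hpos j (by rwa [hval])).le
  refine ⟨c, hcmem, ?_⟩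
  simpa using key Finset.univ

lemma exists_forall_Kfun_le (e : ℕ) :
    ∃ x : Fin e → ℝ, (∀ j, 0 < x j) ∧ ∀ y : Fin e → ℝ, (∀ j, 0 < y j) → Kfun e x ≤ Kfun e y := by
  have hcomp : IsCompact (Set.univ.pi fun _ : Fin e => Set.Icc (1 : ℝ) (13 / 10)) :=
    isCompact_univ_pi fun _ => isCompact_Icc
  have hcont : ContinuousOn (Kfun e) (Set.univ.pi fun _ : Fin e => Set.Icc (1 : ℝ) (13 / 10)) := by
    have h : ContinuousOn (fun x : Fin e → ℝ =>
        2 * ∏ j, ((3 * x j ^ 2 - 4 * x j + 2) / x j ^ 2) - ∏ j, (2 / 3 * x j))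
        (Set.univ.pi fun _ : Fin e => Set.Icc (1 : ℝ) (13 / 10)) := by
      refine ContinuousOn.sub (continuousOn_const.mul (continuousOn_finsetProd _ fun j _ => ?_))
        (by fun_prop)
      refine ContinuousOn.div (by fun_prop) (by fun_prop) fun x hx => ?_
      have := (hx j (Set.mem_univ j)).1
      positivity
    refine h.congr fun x hx => ?_
    rw [Kfun_eq]
    congr 2
    refine Finset.prod_congr rfl fun j _ => ?_
    have := hx j (Set.mem_univ j)
    exact Omega_of_mem_Icc this.1 (by linarith [this.2])
  obtain ⟨x, hx, hmin⟩ := hcomp.exists_isMinOn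
    ⟨fun _ => 1, fun _ _ => by norm_num⟩ hcont
  refine ⟨x, fun j => by linarith [(hx j (Set.mem_univ j)).1], fun y hy => ?_⟩
  obtain ⟨z, hz, hzy⟩ := exists_mem_box_Kfun_le e y hy
  exact (hmin fun j _ => hz j).trans hzy

/-- First-order condition at a global minimizer. -/
lemma critical_of_minimizer (e : ℕ) (x : Fin e → ℝ) (hx : ∀ j, 0 < x j)
    (hmin : ∀ y : Fin e → ℝ, (∀ j, 0 < y j) → Kfun e x ≤ Kfun e y) (j : Fin e) :
    1 < x j ∧ x j < 13 / 10 ∧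
      8 * (x j - 1) * ∏ i, Omega (1 / x i) 0 =
        (3 * x j ^ 2 - 4 * x j + 2) * ∏ i, (2 / 3 * x i) := by
  have hupd : ∀ t, 0 < t → Kfun e x ≤ Kfun e (Function.update x j t) := by
    intro t ht
    refine hmin _ fun i => ?_
    rcases eq_or_ne i j with rfl | hi
    · simpa using ht
    · simpa [Function.update_of_ne hi] using hx i
  have hmem : x j ∈ Set.Ico (1 : ℝ) (13 / 10) := by
    by_contra h
    exact absurd (hupd 1 one_pos) (not_le.mpr (Kfun_update_one_lt e x hx j h))
  obtain ⟨G, U, hU, hUG, hK, hG', hU'⟩ := Kfun_update e x hx j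
  have hG : 0 < G := hU.trans_le hUG
  have hKx := hK (x j)
  rw [Function.update_eq_self] at hKx
  have hle : ∀ t ∈ Set.Icc (1 : ℝ) 2,
      2 * ((3 * x j ^ 2 - 4 * x j + 2) / x j ^ 2 * G) - 2 / 3 * x j * U ≤
        2 * ((3 * t ^ 2 - 4 * t + 2) / t ^ 2 * G) - 2 / 3 * t * U := by
    intro t ht
    have := hupd t (by linarith [ht.1])
    rwa [hKx, hK t, Omega_of_mem_Icc hmem.1 (by linarith [hmem.2]),
      Omega_of_mem_Icc ht.1 ht.2] at this
  have h1 : 1 < x j := by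
    refine lt_of_le_of_ne hmem.1 fun h => ?_
    have hε : 0 < U / (12 * G) := by positivity
    have hε' : U / (12 * G) ≤ 1 := by
      rw [div_le_one (by positivity)]
      linarith
    have hεG : G * (U / (12 * G)) = U / 12 := by field_simp
    set ε := U / (12 * G)
    have := hle (1 + ε) ⟨by linarith, by linarith⟩
    rw [← h] at this
    have hb : (3 * (1 + ε) ^ 2 - 4 * (1 + ε) + 2) / (1 + ε) ^ 2 ≤ 1 + 2 * ε ^ 2 := by
      rw [div_le_iff₀ (by positivity)]
      nlinarith [pow_pos hε 3, pow_pos hε 4]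
    nlinarith [mul_le_mul_of_nonneg_right hb hG.le, mul_pos hε hU, congrArg (· * ε) hεG]
  refine ⟨h1, hmem.2, ?_⟩
  have hxj := hx j
  have hloc : IsLocalMin (fun t : ℝ =>
      2 * ((3 * t ^ 2 - 4 * t + 2) / t ^ 2 * G) - 2 / 3 * t * U) (x j) := by
    filter_upwards [Icc_mem_nhds h1 (by linarith [hmem.2] : x j < 2)] with t ht
    exact hle t ht
  have hder : HasDerivAt (fun t : ℝ =>
      2 * ((3 * t ^ 2 - 4 * t + 2) / t ^ 2 * G) - 2 / 3 * t * U)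
      (8 * (x j - 1) / x j ^ 3 * G - 2 / 3 * U) (x j) := by
    have hn : HasDerivAt (fun t : ℝ => 3 * t ^ 2 - 4 * t + 2) (6 * x j - 4) (x j) := by
      have := (((hasDerivAt_pow 2 (x j)).const_mul 3).sub
        ((hasDerivAt_id (x j)).const_mul 4)).add_const 2
      refine this.congr_deriv ?_
      norm_num
      ring
    have hd := hn.div (hasDerivAt_pow 2 (x j)) (by positivity)
    have := ((hd.mul_const G).const_mul 2).sub
      (((hasDerivAt_id (x j)).const_mul (2 / 3)).mul_const U)
    refine this.congr_deriv ?_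
    norm_num
    field_simp
    ring
  have h0 := hloc.hasDerivAt_eq_zero hder
  rw [hG', hU', Omega_of_mem_Icc hmem.1 (by linarith [hmem.2])]
  have h0' : 8 * (x j - 1) * G = 2 / 3 * U * x j ^ 3 := by
    field_simp at h0
    linarith
  field_simp
  linear_combination (3 * x j ^ 2 - 4 * x j + 2) * 3 * h0'

lemma eq_of_slope_eq {x y m n : ℝ} (hx : x ∈ Set.Ioo (1 : ℝ) (13 / 10))
    (hy : y ∈ Set.Ioo (1 : ℝ) (13 / 10)) (hm : 0 < m)
    (h1 : 8 * (x - 1) * m = (3 * x ^ 2 - 4 * x + 2) * n)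
    (h2 : 8 * (y - 1) * m = (3 * y ^ 2 - 4 * y + 2) * n) : x = y := by
  obtain ⟨hx1, hx2⟩ := hx
  obtain ⟨hy1, hy2⟩ := hy
  have h3 : m * ((x - y) * (1 - 3 * ((x - 1) * (y - 1)))) = 0 := by
    linear_combination (3 * y ^ 2 - 4 * y + 2) / 8 * h1 - (3 * x ^ 2 - 4 * x + 2) / 8 * h2
  have h4 : 0 < 1 - 3 * ((x - 1) * (y - 1)) := by nlinarith
  rcases mul_eq_zero.mp h3 with h | h
  · exact absurd h hm.ne'
  · rcases mul_eq_zero.mp h with h | h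
    · linarith
    · exact absurd h h4.ne'

lemma quad_pos (x : ℝ) : 0 < 3 * x ^ 2 - 4 * x + 2 := by nlinarith [sq_nonneg (3 * x - 2)]

lemma root_iff (e : ℕ) (he : 1 ≤ e) (x : ℝ) :
    x ^ (3 * e) - (3 : ℝ) ^ e / (2 : ℝ) ^ ((e : ℤ) - 3) * (x - 1) *
        (3 * x ^ 2 - 4 * x + 2) ^ (e - 1) = 0 ↔
      8 * (x - 1) / (3 * x ^ 2 - 4 * x + 2) = (2 * x ^ 3 / (3 * (3 * x ^ 2 - 4 * x + 2))) ^ e := by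
  obtain ⟨k, rfl⟩ : ∃ k, e = k + 1 := ⟨e - 1, by omega⟩
  have hD := quad_pos x
  set D := 3 * x ^ 2 - 4 * x + 2
  have hz : (2 : ℝ) ^ (((k + 1 : ℕ) : ℤ) - 3) = 2 ^ (k + 1) / 8 := by
    rw [zpow_sub₀ two_ne_zero, zpow_natCast]
    norm_num
  rw [hz, div_pow, mul_pow, mul_pow, ← pow_mul, Nat.add_sub_cancel, div_eq_div_iff hD.ne'
    (by positivity), pow_succ D k]
  have hmul : x ^ (3 * (k + 1)) - 3 ^ (k + 1) / (2 ^ (k + 1) / 8) * (x - 1) * D ^ k =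
      (2 ^ (k + 1) * x ^ (3 * (k + 1)) * D - 8 * (x - 1) * (3 ^ (k + 1) * (D ^ k * D))) /
        (2 ^ (k + 1) * D) := by
    field_simp
  rw [hmul, div_eq_zero_iff]
  have : (2 : ℝ) ^ (k + 1) * D ≠ 0 := by positivity
  constructor
  · rintro (h | h)
    · linarith
    · exact absurd h this
  · intro h
    left
    linarith

lemma ratio_mem {x : ℝ} (h1 : 1 < x) (h2 : x < 28 / 25) :
    2 * x ^ 3 / (3 * (3 * x ^ 2 - 4 * x + 2)) ≤ 3 / 4 := by
  rw [div_le_iff₀ (by linarith [quad_pos x])]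
  nlinarith [mul_pos (sub_pos.mpr h1) (sub_pos.mpr h2),
    mul_pos (mul_pos (sub_pos.mpr h1) (sub_pos.mpr h2)) (sub_pos.mpr h1)]

lemma root_lt (e : ℕ) (he : 1 ≤ e) {x : ℝ} (h1 : 1 < x) (h2 : x < 13 / 10)
    (h : 8 * (x - 1) / (3 * x ^ 2 - 4 * x + 2) =
      (2 * x ^ 3 / (3 * (3 * x ^ 2 - 4 * x + 2))) ^ e) : x < 28 / 25 := by
  have hD := quad_pos x
  have hF0 : 0 ≤ 2 * x ^ 3 / (3 * (3 * x ^ 2 - 4 * x + 2)) := by positivity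
  have hF1 : 2 * x ^ 3 / (3 * (3 * x ^ 2 - 4 * x + 2)) ≤ 1 := by
    rw [div_le_one (by positivity)]
    nlinarith [mul_pos (sub_pos.mpr h1) (sub_pos.mpr h2),
      mul_pos (mul_pos (sub_pos.mpr h1) (sub_pos.mpr h2)) (sub_pos.mpr h1)]
  have hle := pow_le_of_le_one hF0 hF1 (by omega : e ≠ 0)
  rw [← h, div_le_div_iff₀ hD (by positivity)] at hle
  have hcub : 12 * (x - 1) ≤ x ^ 3 := by
    have : (12 * (x - 1)) * (2 * (3 * x ^ 2 - 4 * x + 2)) ≤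
      x ^ 3 * (2 * (3 * x ^ 2 - 4 * x + 2)) := by linarith
    exact le_of_mul_le_mul_right this (by positivity)
  by_contra hc
  push Not at hc
  nlinarith [mul_nonneg (sub_nonneg.mpr hc) (sub_pos.mpr h2).le,
    mul_nonneg (mul_nonneg (sub_nonneg.mpr hc) (sub_pos.mpr h2).le) (sub_pos.mpr h1).le]

lemma root_lt_bound (e : ℕ) {x : ℝ} (h1 : 1 < x) (h2 : x < 28 / 25)
    (h : 8 * (x - 1) / (3 * x ^ 2 - 4 * x + 2) =
      (2 * x ^ 3 / (3 * (3 * x ^ 2 - 4 * x + 2))) ^ e) :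
    x < 1 + 3 ^ (e + 1) / 2 ^ (2 * e + 4) := by
  have hD := quad_pos x
  have hF0 : 0 ≤ 2 * x ^ 3 / (3 * (3 * x ^ 2 - 4 * x + 2)) := by positivity
  have hpow := pow_le_pow_left₀ hF0 (ratio_mem h1 h2) e
  rw [← h, div_le_iff₀ hD] at hpow
  have hq : (3 : ℝ) ^ (e + 1) / 2 ^ (2 * e + 4) = 3 / 16 * (3 / 4) ^ e := by
    rw [pow_succ, pow_add, pow_mul, div_pow]
    norm_num
    ring
  rw [hq]
  have hD2 : 3 * x ^ 2 - 4 * x + 2 < 3 / 2 := by nlinarith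
  have := mul_lt_mul_of_pos_left hD2 (by positivity : (0 : ℝ) < (3 / 4) ^ e)
  linarith

lemma pow_sub_pow_le_mul {s t : ℝ} (hs : 0 ≤ s) (hst : s ≤ t) (n : ℕ) :
    t ^ (n + 1) - s ^ (n + 1) ≤ (n + 1) * t ^ n * (t - s) := by
  induction n with
  | zero => simp
  | succ n ih =>
    have h1 := mul_le_mul_of_nonneg_right ih (hs.trans hst)
    have h2 := mul_le_mul_of_nonneg_right
      (pow_le_pow_left₀ hs hst (n + 1)) (sub_nonneg.mpr hst)
    push_cast
    calc t ^ (n + 1 + 1) - s ^ (n + 1 + 1)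
        = (t ^ (n + 1) - s ^ (n + 1)) * t + s ^ (n + 1) * (t - s) := by ring
      _ ≤ (n + 1) * t ^ n * (t - s) * t + t ^ (n + 1) * (t - s) := add_le_add h1 h2
      _ = (n + 1 + 1) * t ^ (n + 1) * (t - s) := by ring

lemma succ_mul_pow_le_three (n : ℕ) : ((n : ℝ) + 1) * (3 / 4) ^ n ≤ 3 := by
  have h := one_add_mul_le_pow (by norm_num : (-2 : ℝ) ≤ 1 / 3) n
  have hinv : (3 / 4 : ℝ) ^ n * (1 + 1 / 3) ^ n = 1 := by
    rw [← mul_pow]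
    norm_num
  have h3 := mul_le_mul_of_nonneg_left h (by positivity : (0 : ℝ) ≤ (3 / 4) ^ n)
  have h4 : (0 : ℝ) < (3 / 4) ^ n := by positivity
  nlinarith

lemma root_not_lt (e : ℕ) (he : 1 ≤ e) {x y : ℝ} (hx1 : 1 < x) (hxy : x < y) (hy : y < 28 / 25)
    (hx : 8 * (x - 1) / (3 * x ^ 2 - 4 * x + 2) =
      (2 * x ^ 3 / (3 * (3 * x ^ 2 - 4 * x + 2))) ^ e)
    (hyr : 8 * (y - 1) / (3 * y ^ 2 - 4 * y + 2) =
      (2 * y ^ 3 / (3 * (3 * y ^ 2 - 4 * y + 2))) ^ e) : False := by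
  obtain ⟨n, rfl⟩ : ∃ k, e = k + 1 := ⟨e - 1, by omega⟩
  have hDx := quad_pos x
  have hDy := quad_pos y
  have hF : 2 * y ^ 3 / (3 * (3 * y ^ 2 - 4 * y + 2)) -
      2 * x ^ 3 / (3 * (3 * x ^ 2 - 4 * x + 2)) =
      2 / 3 * (y - x) * (1 + (y - x) ^ 2 + 2 * ((x - 1) * (y - 1)) * (x + y - 2) +
        3 * ((x - 1) * (y - 1)) ^ 2) /
        ((3 * x ^ 2 - 4 * x + 2) * (3 * y ^ 2 - 4 * y + 2)) := by
    rw [div_sub_div _ _ (by positivity) (by positivity), div_eq_div_iff (by positivity)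
      (by positivity)]
    ring
  have hS : 8 * (y - 1) / (3 * y ^ 2 - 4 * y + 2) - 8 * (x - 1) / (3 * x ^ 2 - 4 * x + 2) =
      8 * (y - x) * (1 - 3 * ((x - 1) * (y - 1))) /
        ((3 * x ^ 2 - 4 * x + 2) * (3 * y ^ 2 - 4 * y + 2)) := by
    rw [div_sub_div _ _ hDy.ne' hDx.ne', div_eq_div_iff (by positivity) (by positivity)]
    ring
  have hr0 : 0 < (x - 1) * (y - 1) := mul_pos (by linarith) (by linarith)
  have hr1 : (x - 1) * (y - 1) < 1 / 50 := by nlinarith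
  have hM : 1 + (y - x) ^ 2 + 2 * ((x - 1) * (y - 1)) * (x + y - 2) +
      3 * ((x - 1) * (y - 1)) ^ 2 ≤ 2 := by
    nlinarith
  have hM0 : 0 ≤ 1 + (y - x) ^ 2 + 2 * ((x - 1) * (y - 1)) * (x + y - 2) +
      3 * ((x - 1) * (y - 1)) ^ 2 := by
    have : 0 < x + y - 2 := by linarith
    positivity
  have hyx : 0 < y - x := by linarith
  have hFle : 0 ≤ 2 * y ^ 3 / (3 * (3 * y ^ 2 - 4 * y + 2)) -
      2 * x ^ 3 / (3 * (3 * x ^ 2 - 4 * x + 2)) := by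
    rw [hF]
    positivity
  have hFx0 : 0 ≤ 2 * x ^ 3 / (3 * (3 * x ^ 2 - 4 * x + 2)) := by positivity
  have hFy0 : 0 ≤ 2 * y ^ 3 / (3 * (3 * y ^ 2 - 4 * y + 2)) := by
    have : 0 < y := by linarith
    positivity
  have hp := pow_sub_pow_le_mul hFx0 (sub_nonneg.mp hFle) n
  have hb := mul_le_mul_of_nonneg_left
    (pow_le_pow_left₀ hFy0 (ratio_mem (hx1.trans hxy) hy) n) (by positivity : (0 : ℝ) ≤ n + 1)
  have hle := hp.trans
    (mul_le_mul_of_nonneg_right (hb.trans (succ_mul_pow_le_three n)) hFle)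
  rw [← hx, ← hyr, hS, hF, ← mul_div_assoc, div_le_div_iff_of_pos_right (by positivity)] at hle
  nlinarith

lemma root_unique (e : ℕ) (he : 1 ≤ e) {x y : ℝ} (hx : x ∈ Set.Ioo (1 : ℝ) (13 / 10))
    (hy : y ∈ Set.Ioo (1 : ℝ) (13 / 10))
    (hxr : 8 * (x - 1) / (3 * x ^ 2 - 4 * x + 2) =
      (2 * x ^ 3 / (3 * (3 * x ^ 2 - 4 * x + 2))) ^ e)
    (hyr : 8 * (y - 1) / (3 * y ^ 2 - 4 * y + 2) =
      (2 * y ^ 3 / (3 * (3 * y ^ 2 - 4 * y + 2))) ^ e) : x = y := by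
  rcases lt_trichotomy x y with h | h | h
  · exact (root_not_lt e he hx.1 h (root_lt e he hy.1 hy.2 hyr) hxr hyr).elim
  · exact h
  · exact (root_not_lt e he hy.1 h (root_lt e he hx.1 hx.2 hxr) hyr hxr).elim

/-- A global minimizer is constant, and its value satisfies the root equation. -/
lemma minimizer_const (e : ℕ) (he : 1 ≤ e) (x : Fin e → ℝ) (hx : ∀ j, 0 < x j)
    (hmin : ∀ y : Fin e → ℝ, (∀ j, 0 < y j) → Kfun e x ≤ Kfun e y) :
    ∃ b ∈ Set.Ioo (1 : ℝ) (13 / 10), (∀ j, x j = b) ∧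
      8 * (b - 1) / (3 * b ^ 2 - 4 * b + 2) =
        (2 * b ^ 3 / (3 * (3 * b ^ 2 - 4 * b + 2))) ^ e := by
  have hcrit := critical_of_minimizer e x hx hmin
  have hprod : 0 < ∏ i, Omega (1 / x i) 0 := Finset.prod_pos fun i _ =>
    (mul_pos (by norm_num) (hx i)).trans_le (two_thirds_mul_le_Omega (hx i))
  let j₀ : Fin e := ⟨0, he⟩
  have hconst : ∀ j, x j = x j₀ := fun j =>
    eq_of_slope_eq ⟨(hcrit j).1, (hcrit j).2.1⟩ ⟨(hcrit j₀).1, (hcrit j₀).2.1⟩ hprod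
      (hcrit j).2.2 (hcrit j₀).2.2
  obtain ⟨h1, h2, h3⟩ := hcrit j₀
  refine ⟨x j₀, ⟨h1, h2⟩, hconst, ?_⟩
  simp only [hconst, Finset.prod_const, Finset.card_univ, Fintype.card_fin] at h3
  have hb := hx j₀
  rw [Omega_of_mem_Icc h1.le (by linarith)] at h3
  have hD := quad_pos (x j₀)
  have hdiv : 2 * x j₀ ^ 3 / (3 * (3 * x j₀ ^ 2 - 4 * x j₀ + 2)) =
      2 / 3 * x j₀ / ((3 * x j₀ ^ 2 - 4 * x j₀ + 2) / x j₀ ^ 2) := by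
    field_simp
  rw [hdiv, div_pow, div_eq_div_iff hD.ne' (by positivity), h3]
  ring

/-- `Kfun e` attains a global minimum on the positive orthant, and
`(x_1,…,x_e)` is a global minimizer iff `x_1 = ⋯ = x_e = a_e`, where `a_e` is the unique
root in `(1, 1 + 3^(e+1)/2^(2e+4))` of `x^(3e) - (3^e/2^(e-3))(x-1)(3x²-4x+2)^(e-1)`. -/
theorem stmt_4 (e : ℕ) (he : 1 ≤ e) :
    ∃ a : ℝ, a ∈ Set.Ioo (1 : ℝ) (1 + 3 ^ (e + 1) / 2 ^ (2 * e + 4)) ∧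
      a ^ (3 * e) - (3 : ℝ) ^ e / (2 : ℝ) ^ ((e : ℤ) - 3) * (a - 1) *
        (3 * a ^ 2 - 4 * a + 2) ^ (e - 1) = 0 ∧
      (∀ x ∈ Set.Ioo (1 : ℝ) (1 + 3 ^ (e + 1) / 2 ^ (2 * e + 4)),
        x ^ (3 * e) - (3 : ℝ) ^ e / (2 : ℝ) ^ ((e : ℤ) - 3) * (x - 1) *
          (3 * x ^ 2 - 4 * x + 2) ^ (e - 1) = 0 → x = a) ∧
      (∀ x : Fin e → ℝ, (∀ j, 0 < x j) → Kfun e (fun _ => a) ≤ Kfun e x) ∧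
      (∀ x : Fin e → ℝ, (∀ j, 0 < x j) →
        ((∀ y : Fin e → ℝ, (∀ j, 0 < y j) → Kfun e x ≤ Kfun e y) ↔ ∀ j, x j = a)) := by
  obtain ⟨x₀, hx₀, hmin₀⟩ := exists_forall_Kfun_le e
  obtain ⟨a, ha, hconst, hroot⟩ := minimizer_const e he x₀ hx₀ hmin₀
  have hx₀a : x₀ = fun _ => a := funext hconst
  subst hx₀a
  have hbound : (3 : ℝ) ^ (e + 1) / 2 ^ (2 * e + 4) ≤ 3 / 10 := by
    have hq : (3 : ℝ) ^ (e + 1) / 2 ^ (2 * e + 4) = 3 / 16 * (3 / 4) ^ e := by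
      rw [pow_succ, pow_add, pow_mul, div_pow]
      norm_num
      ring
    have := pow_le_one₀ (n := e) (by norm_num : (0 : ℝ) ≤ 3 / 4) (by norm_num)
    linarith
  refine ⟨a, ⟨ha.1, root_lt_bound e ha.1 (root_lt e he ha.1 ha.2 hroot) hroot⟩,
    (root_iff e he a).mpr hroot, fun x hx hxr => ?_, hmin₀, fun x hx => ⟨fun h => ?_, fun h => ?_⟩⟩
  · exact root_unique e he ⟨hx.1, by linarith [hx.2]⟩ ha ((root_iff e he x).mp hxr) hroot
  · obtain ⟨b, hb, hxb, hbroot⟩ := minimizer_const e he x hx h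
    rw [← root_unique e he hb ha hbroot hroot]
    exact hxb
  · rw [funext h]
    exact hmin₀
end

section
/- For all integers e_1, e_2 ≥ 1, B_{e_1+e_2} < B_{e_1} · B_{e_2}, where for each e ≥ 1, B_e^4 = inf{ −(2^{e+1}/3^e) ∏_{j=1}^e x_j + 2 ∏_{j=1}^e Ω(1/x_j, 0) + ∏_{j=1}^e Ω(1/x_j, 1 + 2y_j/x_j) : x_1,…,x_e > 0, y_1,…,y_e ∈ ℝ } and B_e is the positive fourth root of this infimum (which is positive). -/
/-- `Bquart e` is the infimum of the limiting values of `(‖f‖₄/‖f‖₂)⁴` over size- and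
translation-stable families of `e`-variable quadratic multiplicative character polynomials. -/
noncomputable def Bquart (e : ℕ) : ℝ :=
  sInf {r : ℝ | ∃ x y : Fin e → ℝ, (∀ j, 0 < x j) ∧
    r = -((2 : ℝ) ^ (e + 1) / 3 ^ e) * ∏ j, x j + 2 * ∏ j, Omega (1 / x j) 0 +
      ∏ j, Omega (1 / x j) (1 + 2 * y j / x j)}

/-- `B_e` is the positive fourth root of `Bquart e`. -/
noncomputable def Bconst (e : ℕ) : ℝ := Bquart e ^ ((1 : ℝ) / 4)

/-- `∑_{n ≥ 0} max(0, x - n)^2`. -/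
noncomputable def rampSum (x : ℝ) : ℝ := ∑' n : ℕ, max 0 (x - n) ^ 2

/-- The value of `w ↦ Omega (1 / x) (w / x)` at integers. -/
noncomputable def peak (x : ℝ) : ℝ := (rampSum x + rampSum (x - 1)) / x ^ 2

/-- The value of `w ↦ Omega (1 / x) (w / x)` at half-integers. -/
noncomputable def trough (x : ℝ) : ℝ := 2 * rampSum (x - 1 / 2) / x ^ 2

lemma summable_ramp (x : ℝ) : Summable fun n : ℕ => max 0 (x - n) ^ 2 := by
  refine summable_of_ne_finset_zero (s := Finset.range (⌈x⌉₊)) fun n hn => ?_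
  have h : x ≤ n := Nat.ceil_le.mp (by simpa using hn)
  rw [max_eq_left (by linarith)]
  norm_num

lemma rampSum_nonneg (x : ℝ) : 0 ≤ rampSum x := tsum_nonneg fun _ => by positivity

lemma rampSum_of_nonpos {x : ℝ} (hx : x ≤ 0) : rampSum x = 0 := by
  have h : ∀ n : ℕ, max 0 (x - n) ^ 2 = 0 := fun n => by
    rw [max_eq_left (by linarith [n.cast_nonneg (α := ℝ)])]
    norm_num
  simp only [rampSum, h, tsum_zero]

lemma rampSum_of_nonneg {x : ℝ} (hx : 0 ≤ x) : rampSum x = x ^ 2 + rampSum (x - 1) := by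
  rw [rampSum, (summable_ramp x).tsum_eq_zero_add, rampSum]
  congr 1
  · simp [hx]
  · refine tsum_congr fun n => ?_
    push_cast
    ring_nf

lemma abs_rampSum_sub_le {x : ℝ} (hx : -1 ≤ x) :
    |rampSum x - x * (x + 1) * (2 * x + 1) / 6| ≤ 1 / 60 := by
  have key : ∀ n : ℕ, ∀ x : ℝ, -1 ≤ x → x ≤ n →
      |rampSum x - x * (x + 1) * (2 * x + 1) / 6| ≤ 1 / 60 := by
    intro n
    induction n with
    | zero =>
      intro x h1 h2
      have h2' : x ≤ 0 := by simpa using h2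
      rw [rampSum_of_nonpos h2', abs_le]
      constructor
      · nlinarith [mul_nonneg (by linarith : 0 ≤ x + 1) (sq_nonneg (x + 1 / 5)),
          mul_nonneg (by linarith : 0 ≤ x + 1) (sq_nonneg (x + 4 / 5)),
          mul_nonneg (by linarith : 0 ≤ -x) (sq_nonneg (x + 1 / 5)),
          mul_nonneg (by linarith : 0 ≤ -x) (sq_nonneg (x + 4 / 5))]
      · nlinarith [mul_nonneg (by linarith : 0 ≤ x + 1) (sq_nonneg (x + 1 / 5)),
          mul_nonneg (by linarith : 0 ≤ x + 1) (sq_nonneg (x + 4 / 5)),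
          mul_nonneg (by linarith : 0 ≤ -x) (sq_nonneg (x + 1 / 5)),
          mul_nonneg (by linarith : 0 ≤ -x) (sq_nonneg (x + 4 / 5))]
    | succ k ih =>
      intro x h1 h2
      push_cast at h2
      by_cases hx0 : x ≤ 0
      · exact ih x h1 (hx0.trans k.cast_nonneg)
      · have h := ih (x - 1) (by linarith) (by linarith)
        rw [rampSum_of_nonneg (by linarith)]
        convert h using 2
        ring
  exact key ⌈x⌉₊ x hx (Nat.le_ceil x)

lemma rampSum_midpoint_le (a b : ℝ) : 2 * rampSum ((a + b) / 2) ≤ rampSum a + rampSum b := by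
  rw [rampSum, rampSum, rampSum, ← tsum_mul_left, ← (summable_ramp a).tsum_add (summable_ramp b)]
  refine ((summable_ramp _).mul_left 2).tsum_le_tsum (fun n => ?_)
    ((summable_ramp a).add (summable_ramp b))
  have h : max 0 ((a + b) / 2 - n) ≤ (max 0 (a - n) + max 0 (b - n)) / 2 := by
    refine max_le (by positivity) ?_
    linarith [le_max_right 0 (a - n), le_max_right 0 (b - n)]
  have h0 : 0 ≤ max 0 ((a + b) / 2 - n) := le_max_left _ _
  nlinarith [sq_nonneg (max 0 (a - n) - max 0 (b - n))]

lemma Omega_eq_of_mem_Icc {x u : ℝ} (hx : 0 < x) (hu0 : 0 ≤ u) (hu1 : u ≤ 1) :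
    Omega (1 / x) (-u / x) = (rampSum (x - u) + rampSum (x - 1 + u)) / x ^ 2 := by
  have hterm : ∀ s : ℝ, max 0 (1 - s / x) ^ 2 = max 0 (x - s) ^ 2 / x ^ 2 := by
    intro s
    rw [← div_pow, show max 0 (x - s) / x = max 0 (1 - s / x) by
      rw [← max_div_div_right hx.le, zero_div, sub_div, div_self hx.ne']]
  have h1 : ∀ n : ℕ, max 0 (1 - |1 / x * ((n : ℤ) : ℝ) - -u / x|) ^ 2
      = max 0 (x - u - n) ^ 2 / x ^ 2 := by
    intro n
    rw [show 1 / x * ((n : ℤ) : ℝ) - -u / x = (n + u) / x by push_cast; ring,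
      abs_of_nonneg (by positivity), hterm]
    ring_nf
  have h2 : ∀ n : ℕ, max 0 (1 - |1 / x * ((-((n : ℤ) + 1) : ℤ) : ℝ) - -u / x|) ^ 2
      = max 0 (x - 1 + u - n) ^ 2 / x ^ 2 := by
    intro n
    rw [show 1 / x * ((-((n : ℤ) + 1) : ℤ) : ℝ) - -u / x = -((n + (1 - u)) / x) by
        push_cast; ring, abs_neg,
      abs_of_nonneg (div_nonneg (add_nonneg n.cast_nonneg (by linarith)) hx.le), hterm]
    ring_nf
  rw [Omega, tsum_of_nat_of_neg_add_one]
  · simp only [h1, h2]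
    rw [tsum_div_const, tsum_div_const, ← add_div, rampSum, rampSum]
  · simp only [h1]
    exact (summable_ramp _).div_const _
  · simp only [h2]
    exact (summable_ramp _).div_const _

lemma Omega_add_int {x : ℝ} (w : ℝ) (k : ℤ) :
    Omega (1 / x) ((w + k) / x) = Omega (1 / x) (w / x) := by
  rw [Omega, ← (Equiv.addRight k).tsum_eq, Omega]
  refine tsum_congr fun n => ?_
  rw [show 1 / x * ((Equiv.addRight k n : ℤ) : ℝ) - (w + k) / x = 1 / x * (n : ℝ) - w / x by
    rw [Equiv.coe_addRight]; push_cast; ring]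

lemma Omega_zero {x : ℝ} (hx : 0 < x) : Omega (1 / x) 0 = peak x := by
  simpa [peak] using Omega_eq_of_mem_Icc hx le_rfl zero_le_one

lemma Omega_half {x : ℝ} (hx : 0 < x) : Omega (1 / x) (-(1 / 2) / x) = trough x := by
  rw [Omega_eq_of_mem_Icc hx (by norm_num) (by norm_num), trough]
  ring_nf

lemma trough_le_Omega {x : ℝ} (hx : 0 < x) (w : ℝ) : trough x ≤ Omega (1 / x) (w / x) := by
  have hw : w = -Int.fract (-w) + ((-⌊-w⌋ : ℤ) : ℝ) := by
    rw [Int.fract]; push_cast; ring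
  rw [hw, Omega_add_int,
    Omega_eq_of_mem_Icc hx (Int.fract_nonneg _) (Int.fract_lt_one _).le, trough]
  have h := rampSum_midpoint_le (x - Int.fract (-w)) (x - 1 + Int.fract (-w))
  rw [show (x - Int.fract (-w) + (x - 1 + Int.fract (-w))) / 2 = x - 1 / 2 by ring] at h
  gcongr

lemma trough_nonneg (x : ℝ) : 0 ≤ trough x := by
  have := rampSum_nonneg (x - 1 / 2)
  unfold trough
  positivity

lemma peak_of_mem_Icc {x : ℝ} (h1 : 1 ≤ x) (h2 : x ≤ 3 / 2) :
    peak x = (3 * x ^ 2 - 4 * x + 2) / x ^ 2 := by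
  rw [peak, rampSum_of_nonneg (x := x) (by linarith), rampSum_of_nonneg (x := x - 1) (by linarith),
    rampSum_of_nonpos (by linarith)]
  ring

lemma trough_of_mem_Icc {x : ℝ} (h1 : 1 / 2 ≤ x) (h2 : x ≤ 3 / 2) :
    trough x = (2 * x - 1) ^ 2 / (2 * x ^ 2) := by
  rw [trough, rampSum_of_nonneg (by linarith), rampSum_of_nonpos (by linarith)]
  ring

lemma trough_of_le_half {x : ℝ} (h : x ≤ 1 / 2) : trough x = 0 := by
  rw [trough, rampSum_of_nonpos (by linarith)]
  simp

lemma peak_of_le_one {x : ℝ} (hx : 0 < x) (h : x ≤ 1) : peak x = 1 := by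
  rw [peak, rampSum_of_nonneg hx.le, rampSum_of_nonpos (by linarith)]
  field_simp
  ring

lemma trough_pos {x : ℝ} (h : 1 ≤ x) : 0 < trough x := by
  rw [trough, rampSum_of_nonneg (by linarith)]
  have := rampSum_nonneg (x - 1 / 2 - 1)
  have : 0 < (x - 1 / 2) ^ 2 := by nlinarith
  positivity

lemma peak_bound {x : ℝ} (hx : 0 < x) : 2 * x ^ 3 / 3 + x / 3 - 1 / 30 ≤ peak x * x ^ 2 := by
  have h1 := abs_le.mp (abs_rampSum_sub_le (x := x) (by linarith))
  have h2 := abs_le.mp (abs_rampSum_sub_le (x := x - 1) (by linarith))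
  rw [peak, div_mul_cancel₀ _ (by positivity)]
  nlinarith

lemma trough_bounds {x : ℝ} (hx : 0 < x) :
    2 * x ^ 3 / 3 - x / 6 - 1 / 30 ≤ trough x * x ^ 2 ∧
      trough x * x ^ 2 ≤ 2 * x ^ 3 / 3 - x / 6 + 1 / 30 := by
  have h1 := abs_le.mp (abs_rampSum_sub_le (x := x - 1 / 2) (by linarith))
  rw [trough, div_mul_cancel₀ _ (by positivity)]
  constructor <;> nlinarith

lemma le_peak {x : ℝ} (hx : 0 < x) : 2 / 3 * x ≤ peak x := by
  rcases le_total x 1 with h | h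
  · rw [peak_of_le_one hx h]
    linarith
  · refine le_of_mul_le_mul_right ?_ (pow_pos hx 2)
    nlinarith [peak_bound hx]

lemma trough_le {x : ℝ} (hx : 0 < x) : trough x ≤ 2 / 3 * x := by
  rcases le_total x (1 / 2) with h | h
  · rw [trough_of_le_half h]
    positivity
  · refine le_of_mul_le_mul_right ?_ (pow_pos hx 2)
    nlinarith [(trough_bounds hx).2]

lemma sq_le_peak_mul_trough {x : ℝ} (h1 : 1 ≤ x) : (2 / 3 * x) ^ 2 ≤ peak x * trough x := by
  have hx : 0 < x := by linarith
  rcases le_total x (3 / 2) with h | h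
  · rw [peak_of_mem_Icc h1 h, trough_of_mem_Icc (by linarith) h, div_mul_div_comm,
      le_div_iff₀ (by positivity)]
    obtain ⟨t, rfl⟩ : ∃ t, x = 1 + t := ⟨x - 1, by ring⟩
    have ht0 : 0 ≤ t := by linarith
    have ht : 0 ≤ 1 / 2 - t := by linarith
    have e1 : 0 ≤ t ^ 3 * (1 / 2 - t) := by positivity
    have e2 : 0 ≤ t ^ 4 * (1 / 2 - t) := by positivity
    have e3 : 0 ≤ t ^ 5 * (1 / 2 - t) := by positivity
    have e4 : 0 ≤ t ^ 3 := by positivity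
    nlinarith [sq_nonneg t]
  · refine le_of_mul_le_mul_right ?_ (pow_pos hx 4)
    have hp := peak_bound hx
    have ht := (trough_bounds hx).1
    have h3 : 0 ≤ 2 * x ^ 3 / 3 - x / 6 - 1 / 30 := by nlinarith [sq_nonneg (x - 1)]
    have hm := mul_le_mul hp ht h3 (h3.trans (by nlinarith))
    have : (2 / 3 * x) ^ 2 * x ^ 4 ≤
        (2 * x ^ 3 / 3 + x / 3 - 1 / 30) * (2 * x ^ 3 / 3 - x / 6 - 1 / 30) := by
      have : 0 ≤ x ^ 3 * (x - 3 / 2) := mul_nonneg (by positivity) (by linarith)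
      have : 0 ≤ x ^ 2 * (x - 3 / 2) := mul_nonneg (by positivity) (by linarith)
      nlinarith
    nlinarith

lemma half_sub_trough_le {x : ℝ} (hx : 0 < x) (h1 : x ≤ 1) :
    1 / 2 - trough x ≤ 4 / 3 * (1 - x) := by
  rcases le_total x (1 / 2) with h | h
  · rw [trough_of_le_half h]
    linarith
  · rw [trough_of_mem_Icc h (by linarith), sub_le_comm, le_div_iff₀ (by positivity)]
    nlinarith [mul_nonneg (sub_nonneg.2 h) (sub_nonneg.2 h1), sq_nonneg (x - 3 / 4),
      mul_nonneg (sub_nonneg.2 h) (sq_nonneg (x - 3 / 4)),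
      mul_nonneg (sub_nonneg.2 h1) (sq_nonneg (x - 3 / 4))]

lemma half_le_trough {x : ℝ} (h : 3 / 2 ≤ x) : 1 / 2 ≤ trough x := by
  have hx : 0 < x := by linarith
  refine le_of_mul_le_mul_right ?_ (pow_pos hx 2)
  nlinarith [(trough_bounds hx).1, mul_nonneg (sub_nonneg.2 h) (sq_nonneg x)]

lemma trough_sub_half_le {x : ℝ} (h : 3 / 2 ≤ x) : trough x - 1 / 2 ≤ 2 * (peak x - 1) := by
  have hx : 0 < x := by linarith
  refine le_of_mul_le_mul_right ?_ (pow_pos hx 2)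
  nlinarith [(trough_bounds hx).2, peak_bound hx, mul_nonneg (sub_nonneg.2 h) (sq_nonneg x),
    mul_nonneg (sub_nonneg.2 h) (sub_nonneg.2 h)]

lemma lt_peak_add_trough {x : ℝ} (h : 3 / 2 ≤ x) :
    4 / 3 * (x - 1) < 2 * (peak x - 1) + (trough x - 1 / 2) := by
  have hx : 0 < x := by linarith
  refine lt_of_mul_lt_mul_right ?_ (pow_pos hx 2).le
  nlinarith [(trough_bounds hx).1, peak_bound hx, mul_nonneg (sub_nonneg.2 h) (sq_nonneg x),
    mul_nonneg (sub_nonneg.2 h) (sub_nonneg.2 h)]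

lemma lt_peak_add_two_mul_trough {x : ℝ} (h1 : 1 < x) (h2 : x < 3 / 2) :
    3 * (2 / 3 * x) < peak x + 2 * trough x := by
  have hx : 0 < x := by linarith
  rw [peak_of_mem_Icc h1.le h2.le, trough_of_mem_Icc (by linarith) h2.le, ← sub_pos]
  have : (3 * x ^ 2 - 4 * x + 2) / x ^ 2 + 2 * ((2 * x - 1) ^ 2 / (2 * x ^ 2)) - 3 * (2 / 3 * x)
      = (x - 1) ^ 2 * (3 - 2 * x) / x ^ 2 := by
    field_simp
    ring
  rw [this]
  have := sub_pos.2 h1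
  have : 0 < 3 - 2 * x := by linarith
  positivity

section Form

variable {ι : Type*}

lemma prod_average_pos {x : ι → ℝ} (hx : ∀ j, 0 < x j) (s : Finset ι) :
    0 < ∏ j ∈ s, (2 / 3 * x j) :=
  Finset.prod_pos fun j _ => by have := hx j; positivity

lemma prod_average_le_prod_peak {x : ι → ℝ} (hx : ∀ j, 0 < x j) (s : Finset ι) :
    ∏ j ∈ s, (2 / 3 * x j) ≤ ∏ j ∈ s, peak (x j) :=
  Finset.prod_le_prod (fun j _ => by have := hx j; positivity) fun j _ => le_peak (hx j)

lemma prod_trough_nonneg (x : ι → ℝ) (s : Finset ι) : 0 ≤ ∏ j ∈ s, trough (x j) :=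
  Finset.prod_nonneg fun j _ => trough_nonneg (x j)

lemma prod_trough_le_prod_average {x : ι → ℝ} (hx : ∀ j, 0 < x j) (s : Finset ι) :
    ∏ j ∈ s, trough (x j) ≤ ∏ j ∈ s, (2 / 3 * x j) :=
  Finset.prod_le_prod (fun j _ => trough_nonneg (x j)) fun j _ => trough_le (hx j)

variable [Fintype ι]

/-- The quantity minimised in `Bquart`, with every `Omega` evaluated at its minimum in `y`. -/
noncomputable def latticeForm (x : ι → ℝ) : ℝ :=
  -2 * ∏ j, (2 / 3 * x j) + 2 * ∏ j, peak (x j) + ∏ j, trough (x j)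

lemma prod_comp_update [DecidableEq ι] (f : ℝ → ℝ) (x : ι → ℝ) (i : ι) (z : ℝ) :
    ∏ j, f (Function.update x i z j) = f z * ∏ j ∈ Finset.univ.erase i, f (x j) := by
  rw [← Finset.mul_prod_erase _ _ (Finset.mem_univ i), Function.update_self]
  congr 1
  refine Finset.prod_congr rfl fun j hj => ?_
  rw [Function.update_of_ne (Finset.ne_of_mem_erase hj)]

lemma latticeForm_update [DecidableEq ι] (x : ι → ℝ) (i : ι) (z : ℝ) :
    latticeForm (Function.update x i z) =
      -2 * (2 / 3 * z * ∏ j ∈ Finset.univ.erase i, (2 / 3 * x j)) +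
        2 * (peak z * ∏ j ∈ Finset.univ.erase i, peak (x j)) +
        trough z * ∏ j ∈ Finset.univ.erase i, trough (x j) := by
  rw [latticeForm, prod_comp_update peak, prod_comp_update trough,
    prod_comp_update (fun t => 2 / 3 * t)]

lemma peak_one : peak 1 = 1 := peak_of_le_one one_pos le_rfl

lemma trough_one : trough 1 = 1 / 2 := by
  rw [trough_of_mem_Icc (by norm_num) (by norm_num)]
  norm_num

lemma latticeForm_update_one_le [DecidableEq ι] {x : ι → ℝ} (hx : ∀ j, 0 < x j) {i : ι}
    (hi : x i ≤ 1) : latticeForm (Function.update x i 1) ≤ latticeForm x := by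
  conv_rhs => rw [← Function.update_eq_self i x]
  rw [latticeForm_update, latticeForm_update, peak_one, trough_one, peak_of_le_one (hx i) hi]
  have h1 := half_sub_trough_le (hx i) hi
  have hC := prod_trough_nonneg x (Finset.univ.erase i)
  have hCA := prod_trough_le_prod_average hx (Finset.univ.erase i)
  nlinarith [mul_le_mul_of_nonneg_right h1 hC,
    mul_le_mul_of_nonneg_left hCA (by linarith : 0 ≤ 4 / 3 * (1 - x i))]

lemma latticeForm_update_one_lt [DecidableEq ι] {x : ι → ℝ} (hx : ∀ j, 1 ≤ x j) {i : ι}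
    (hi : 3 / 2 ≤ x i) : latticeForm (Function.update x i 1) < latticeForm x := by
  have hx0 : ∀ j, 0 < x j := fun j => one_pos.trans_le (hx j)
  conv_rhs => rw [← Function.update_eq_self i x]
  rw [latticeForm_update, latticeForm_update, peak_one, trough_one]
  have h1 := half_le_trough hi
  have h2 := trough_sub_half_le hi
  have h3 := lt_peak_add_trough hi
  have hA := prod_average_pos hx0 (Finset.univ.erase i)
  have hAB := prod_average_le_prod_peak hx0 (Finset.univ.erase i)
  have hBC : (∏ j ∈ Finset.univ.erase i, (2 / 3 * x j)) ^ 2 ≤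
      (∏ j ∈ Finset.univ.erase i, peak (x j)) * ∏ j ∈ Finset.univ.erase i, trough (x j) := by
    rw [← Finset.prod_pow, ← Finset.prod_mul_distrib]
    exact Finset.prod_le_prod (fun j _ => sq_nonneg _) fun j _ => sq_le_peak_mul_trough (hx j)
  set A := ∏ j ∈ Finset.univ.erase i, (2 / 3 * x j)
  set B := ∏ j ∈ Finset.univ.erase i, peak (x j)
  set C := ∏ j ∈ Finset.univ.erase i, trough (x j)
  have hB : 0 < B := hA.trans_le hAB
  have hC : 2 * A ≤ B + C := by nlinarith [sq_nonneg (A - B)]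
  have e1 : 0 ≤ (2 * (peak (x i) - 1) - (trough (x i) - 1 / 2)) * (B - A) :=
    mul_nonneg (by linarith) (by linarith)
  have e2 : 0 ≤ (trough (x i) - 1 / 2) * (B + C - 2 * A) :=
    mul_nonneg (by linarith) (by linarith)
  have e3 := mul_lt_mul_of_pos_right h3 hA
  nlinarith

lemma exists_one_le_latticeForm_le {x : ι → ℝ} (hx : ∀ j, 0 < x j) :
    ∃ x' : ι → ℝ, (∀ j, 1 ≤ x' j) ∧ latticeForm x' ≤ latticeForm x := by
  classical
  have key : ∀ s : Finset ι, ∃ x' : ι → ℝ, (∀ j, 0 < x' j) ∧ (∀ j ∈ s, 1 ≤ x' j) ∧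
      latticeForm x' ≤ latticeForm x := by
    intro s
    induction s using Finset.induction_on with
    | empty => exact ⟨x, hx, by simp, le_rfl⟩
    | insert i s _ ih =>
      obtain ⟨x', h0, h1, h2⟩ := ih
      by_cases hi : 1 ≤ x' i
      · exact ⟨x', h0, by simpa [hi] using h1, h2⟩
      · refine ⟨Function.update x' i 1, fun j => ?_, fun j hj => ?_,
          (latticeForm_update_one_le h0 (not_le.1 hi).le).trans h2⟩
        · rcases eq_or_ne j i with rfl | hji
          · simp
          · simpa [hji] using h0 j
        · rcases eq_or_ne j i with rfl | hji
          · simp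
          · simpa [hji] using h1 j (Finset.mem_of_mem_insert_of_ne hj hji)
  obtain ⟨x', _, h1, h2⟩ := key Finset.univ
  exact ⟨x', fun j => h1 j (Finset.mem_univ j), h2⟩

lemma exists_mem_Icc_latticeForm_le {x : ι → ℝ} (hx : ∀ j, 0 < x j) :
    ∃ x' : ι → ℝ, (∀ j, x' j ∈ Set.Icc (1 : ℝ) (3 / 2)) ∧ latticeForm x' ≤ latticeForm x := by
  classical
  have key : ∀ s : Finset ι, ∃ x' : ι → ℝ, (∀ j, 1 ≤ x' j) ∧ (∀ j ∈ s, x' j ≤ 3 / 2) ∧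
      latticeForm x' ≤ latticeForm x := by
    intro s
    induction s using Finset.induction_on with
    | empty =>
      obtain ⟨x', h0, h1⟩ := exists_one_le_latticeForm_le hx
      exact ⟨x', h0, by simp, h1⟩
    | insert i s _ ih =>
      obtain ⟨x', h0, h1, h2⟩ := ih
      by_cases hi : x' i ≤ 3 / 2
      · exact ⟨x', h0, by simpa [hi] using h1, h2⟩
      · refine ⟨Function.update x' i 1, fun j => ?_, fun j hj => ?_,
          (latticeForm_update_one_lt h0 (not_le.1 hi).le).le.trans h2⟩
        · rcases eq_or_ne j i with rfl | hji
          · simp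
          · simpa [hji] using h0 j
        · rcases eq_or_ne j i with rfl | hji
          · norm_num
          · simpa [hji] using h1 j (Finset.mem_of_mem_insert_of_ne hj hji)
  obtain ⟨x', h0, h1, h2⟩ := key Finset.univ
  exact ⟨x', fun j => ⟨h0 j, h1 j (Finset.mem_univ j)⟩, h2⟩

lemma continuousOn_latticeForm :
    ContinuousOn (latticeForm (ι := ι)) (Set.univ.pi fun _ => Set.Icc (1 : ℝ) (3 / 2)) := by
  have hp : ContinuousOn peak (Set.Icc (1 : ℝ) (3 / 2)) := by
    refine ContinuousOn.congr (f := fun x => (3 * x ^ 2 - 4 * x + 2) / x ^ 2) ?_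
      fun x hx => peak_of_mem_Icc hx.1 hx.2
    exact ContinuousOn.div (by fun_prop) (by fun_prop) fun x hx =>
      pow_ne_zero 2 (by linarith [hx.1])
  have ht : ContinuousOn trough (Set.Icc (1 : ℝ) (3 / 2)) := by
    refine ContinuousOn.congr (f := fun x => (2 * x - 1) ^ 2 / (2 * x ^ 2)) ?_
      fun x hx => trough_of_mem_Icc (by linarith [hx.1]) hx.2
    exact ContinuousOn.div (by fun_prop) (by fun_prop) fun x hx =>
      mul_ne_zero two_ne_zero (pow_ne_zero 2 (by linarith [hx.1]))
  have hcomp : ∀ {f : ℝ → ℝ}, ContinuousOn f (Set.Icc (1 : ℝ) (3 / 2)) → ∀ j : ι,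
      ContinuousOn (fun x : ι → ℝ => f (x j)) (Set.univ.pi fun _ => Set.Icc (1 : ℝ) (3 / 2)) :=
    fun hf j => hf.comp (by fun_prop) fun x hx => hx j (Set.mem_univ j)
  unfold latticeForm
  exact ((continuousOn_const.mul (by fun_prop)).add
    (continuousOn_const.mul (continuousOn_finsetProd _ fun j _ => hcomp hp j))).add
    (continuousOn_finsetProd _ fun j _ => hcomp ht j)

lemma exists_latticeForm_update_lt [DecidableEq ι] {x : ι → ℝ} (hx : ∀ j, 0 < x j) {i : ι}
    (hi : x i = 1) :
    ∃ z ∈ Set.Icc (1 : ℝ) (3 / 2), latticeForm (Function.update x i z) < latticeForm x := by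
  have hA := prod_average_pos hx (Finset.univ.erase i)
  have hAB := prod_average_le_prod_peak hx (Finset.univ.erase i)
  have hCA := prod_trough_le_prod_average hx (Finset.univ.erase i)
  have hC := prod_trough_nonneg x (Finset.univ.erase i)
  have hform := latticeForm_update x i (x i)
  rw [Function.update_eq_self, hi, peak_one, trough_one] at hform
  simp only [hform, latticeForm_update]
  set A := ∏ j ∈ Finset.univ.erase i, (2 / 3 * x j)
  set B := ∏ j ∈ Finset.univ.erase i, peak (x j)
  set C := ∏ j ∈ Finset.univ.erase i, trough (x j)
  have hB : 0 < B := hA.trans_le hAB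
  obtain ⟨t, ht⟩ : ∃ t, t = A / (13 * B) := ⟨_, rfl⟩
  have ht0 : 0 < t := by rw [ht]; positivity
  have htB : 13 * B * t = A := by rw [ht]; field_simp
  have ht1 : t ≤ 1 / 13 := by
    rw [ht, div_le_iff₀ (by positivity)]
    linarith
  have hp : peak (1 + t) ≤ 1 + 2 * t ^ 2 := by
    rw [peak_of_mem_Icc (by linarith) (by linarith), div_le_iff₀ (by positivity)]
    nlinarith [pow_pos ht0 3, pow_pos ht0 4]
  have hq : trough (1 + t) ≤ 1 / 2 + t := by
    rw [trough_of_mem_Icc (by linarith) (by linarith), div_le_iff₀ (by positivity)]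
    nlinarith [pow_pos ht0 3, pow_pos ht0 2]
  refine ⟨1 + t, ⟨by linarith, by linarith⟩, ?_⟩
  have e1 := mul_le_mul_of_nonneg_right hp hB.le
  have e2 := mul_le_mul_of_nonneg_right hq hC
  have e3 := mul_le_mul_of_nonneg_left hCA ht0.le
  have e4 : 13 * (B * t ^ 2) = t * A := by rw [← htB]; ring
  have e5 := mul_pos ht0 hA
  nlinarith

lemma exists_minimizer_latticeForm :
    ∃ x : ι → ℝ, (∀ j, x j ∈ Set.Ioo (1 : ℝ) (3 / 2)) ∧
      ∀ x' : ι → ℝ, (∀ j, 0 < x' j) → latticeForm x ≤ latticeForm x' := by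
  classical
  obtain ⟨x, hxK, hmin⟩ := (isCompact_univ_pi fun _ : ι => isCompact_Icc).exists_isMinOn
    (⟨fun _ => 1, fun _ _ => by norm_num⟩ :
      (Set.univ.pi fun _ : ι => Set.Icc (1 : ℝ) (3 / 2)).Nonempty) continuousOn_latticeForm
  have hx : ∀ j, x j ∈ Set.Icc (1 : ℝ) (3 / 2) := fun j => hxK j (Set.mem_univ j)
  have hx0 : ∀ j, 0 < x j := fun j => one_pos.trans_le (hx j).1
  have hle : ∀ x' : ι → ℝ, (∀ j, 0 < x' j) → latticeForm x ≤ latticeForm x' := by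
    intro x' hx'
    obtain ⟨x'', h1, h2⟩ := exists_mem_Icc_latticeForm_le hx'
    exact (hmin (fun j _ => h1 j)).trans h2
  have hupd : ∀ i z, 0 < z → ∀ j, 0 < Function.update x i z j := by
    intro i z hz j
    rcases eq_or_ne j i with rfl | hji
    · simpa using hz
    · simpa [hji] using hx0 j
  refine ⟨x, fun j => ⟨lt_of_le_of_ne (hx j).1 fun h => ?_,
    lt_of_le_of_ne (hx j).2 fun h => ?_⟩, hle⟩
  · obtain ⟨z, hz, hlt⟩ := exists_latticeForm_update_lt hx0 h.symm
    exact (hle _ (hupd j z (by linarith [hz.1]))).not_gt hlt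
  · exact (hle _ (hupd j 1 one_pos)).not_gt
      (latticeForm_update_one_lt (fun j => (hx j).1) h.ge)

lemma lt_prod_peak_add_prod_trough [Nonempty ι] {x : ι → ℝ}
    (hx : ∀ j, x j ∈ Set.Ioo (1 : ℝ) (3 / 2)) :
    3 * ∏ j, (2 / 3 * x j) < ∏ j, peak (x j) + 2 * ∏ j, trough (x j) := by
  have hx0 : ∀ j, 0 < x j := fun j => one_pos.trans (hx j).1
  refine Finset.Nonempty.cons_induction (s := Finset.univ)
    (motive := fun s _ => 3 * ∏ j ∈ s, (2 / 3 * x j) <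
      ∏ j ∈ s, peak (x j) + 2 * ∏ j ∈ s, trough (x j)) ?_ ?_ Finset.univ_nonempty
  · intro j
    simpa using lt_peak_add_two_mul_trough (hx j).1 (hx j).2
  · intro i s hi _ ih
    simp only [Finset.prod_cons]
    have hA := prod_average_pos hx0 s
    have hAB := prod_average_le_prod_peak hx0 s
    have hCA := prod_trough_le_prod_average hx0 s
    have hi' := lt_peak_add_two_mul_trough (hx i).1 (hx i).2
    have e1 := mul_nonneg
      (sub_nonneg.2 ((trough_le (hx0 i)).trans (le_peak (hx0 i)))) (sub_nonneg.2 (hCA.trans hAB))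
    have hxi := hx0 i
    have e2 := mul_lt_mul'' hi' ih (by positivity) (by positivity)
    nlinarith

lemma latticeForm_pos {x : ι → ℝ} (hx : ∀ j, 1 ≤ x j) : 0 < latticeForm x := by
  have h1 := prod_average_le_prod_peak (fun j => one_pos.trans_le (hx j)) Finset.univ
  have h2 : 0 < ∏ j, trough (x j) := Finset.prod_pos fun j _ => trough_pos (hx j)
  unfold latticeForm
  linarith

end Form

lemma latticeForm_append_lt {m n : ℕ} [NeZero m] [NeZero n] {x : Fin m → ℝ} {y : Fin n → ℝ}
    (hx : ∀ j, x j ∈ Set.Ioo (1 : ℝ) (3 / 2)) (hy : ∀ j, y j ∈ Set.Ioo (1 : ℝ) (3 / 2)) :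
    latticeForm (Fin.append x y) < latticeForm x * latticeForm y := by
  have hx1 := lt_prod_peak_add_prod_trough hx
  have hy1 := lt_prod_peak_add_prod_trough hy
  have hx2 := prod_trough_le_prod_average (fun j => one_pos.trans (hx j).1) Finset.univ
  have hy2 := prod_trough_le_prod_average (fun j => one_pos.trans (hy j).1) Finset.univ
  simp only [latticeForm, Fin.prod_univ_add, Fin.append_left, Fin.append_right]
  have hx3 : ∏ j, (2 / 3 * x j) < ∏ j, peak (x j) := by linarith
  have hy3 : ∏ j, (2 / 3 * y j) < ∏ j, peak (y j) := by linarith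
  nlinarith [mul_pos (sub_pos.2 hx3) (sub_pos.2 hy1), mul_pos (sub_pos.2 hy3) (sub_pos.2 hx1)]

lemma Omega_one_add {x : ℝ} (hx : 0 < x) (y : ℝ) :
    Omega (1 / x) (1 + 2 * y / x) = Omega (1 / x) ((x + 2 * y) / x) := by
  rw [add_div, div_self hx.ne']

lemma average_prod (e : ℕ) (x : Fin e → ℝ) :
    -((2 : ℝ) ^ (e + 1) / 3 ^ e) * ∏ j, x j = -2 * ∏ j, (2 / 3 * x j) := by
  rw [Finset.prod_mul_distrib, Finset.prod_const, Finset.card_univ, Fintype.card_fin, div_pow]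
  ring

/-- `Bquart` is the least value of `latticeForm` over positive arguments. -/
lemma Bquart_eq {e : ℕ} {x : Fin e → ℝ} (hx : ∀ j, 0 < x j)
    (hmin : ∀ x' : Fin e → ℝ, (∀ j, 0 < x' j) → latticeForm x ≤ latticeForm x') :
    Bquart e = latticeForm x := by
  refine IsLeast.csInf_eq ⟨⟨x, fun j => (-(1 / 2) - x j) / 2, hx, ?_⟩, ?_⟩
  · rw [latticeForm, average_prod]
    congr 1
    · congr 2
      exact Finset.prod_congr rfl fun j _ => (Omega_zero (hx j)).symm
    · refine Finset.prod_congr rfl fun j _ => ?_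
      rw [Omega_one_add (hx j), ← Omega_half (hx j)]
      ring_nf
  · rintro r ⟨x', y, hx', rfl⟩
    refine (hmin x' hx').trans ?_
    rw [latticeForm, average_prod, Finset.prod_congr rfl fun j _ => Omega_zero (hx' j)]
    refine add_le_add le_rfl (Finset.prod_le_prod (fun j _ => trough_nonneg _) fun j _ => ?_)
    rw [Omega_one_add (hx' j)]
    exact trough_le_Omega (hx' j) _

/-- for all `e₁, e₂ ≥ 1`, the infima are positive and
`B_{e₁+e₂} < B_{e₁} · B_{e₂}`. -/
theorem stmt_8 (e₁ e₂ : ℕ) (he₁ : 1 ≤ e₁) (he₂ : 1 ≤ e₂) :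
    0 < Bquart e₁ ∧ 0 < Bquart e₂ ∧ 0 < Bquart (e₁ + e₂) ∧
      Bconst (e₁ + e₂) < Bconst e₁ * Bconst e₂ := by
  have : NeZero e₁ := ⟨by omega⟩
  have : NeZero e₂ := ⟨by omega⟩
  obtain ⟨x, hx, hxmin⟩ := exists_minimizer_latticeForm (ι := Fin e₁)
  obtain ⟨y, hy, hymin⟩ := exists_minimizer_latticeForm (ι := Fin e₂)
  obtain ⟨z, hz, hzmin⟩ := exists_minimizer_latticeForm (ι := Fin (e₁ + e₂))
  have hlt : latticeForm z < latticeForm x * latticeForm y := by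
    refine (hzmin (Fin.append x y) fun j => ?_).trans_lt (latticeForm_append_lt hx hy)
    refine Fin.addCases (fun i => ?_) (fun i => ?_) j
    · rw [Fin.append_left]
      exact one_pos.trans (hx i).1
    · rw [Fin.append_right]
      exact one_pos.trans (hy i).1
  have hxpos := latticeForm_pos fun j => (hx j).1.le
  have hypos := latticeForm_pos fun j => (hy j).1.le
  have hzpos := latticeForm_pos fun j => (hz j).1.le
  rw [Bconst, Bconst, Bconst, Bquart_eq (fun j => one_pos.trans (hx j).1) hxmin,
    Bquart_eq (fun j => one_pos.trans (hy j).1) hymin,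
    Bquart_eq (fun j => one_pos.trans (hz j).1) hzmin]
  refine ⟨hxpos, hypos, hzpos, ?_⟩
  rw [← Real.mul_rpow hxpos.le hypos.le]
  exact Real.rpow_lt_rpow hzpos.le hlt (by norm_num)
end
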